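/- Suppose there is ε ∈ (0, 1] with ν^i_a(x) ≥ ε for all i, a, x. Let H(p) = max over a ∈ {1,…,K} of inf over q ∈ Δ_X of Σ_{i=1}^m p_i·D(q‖ν^i_a) and H̃ = −H. Let Δt, Δh > 0 satisfy the CFL condition 1 − (m·Δt/Δh)·log(1/ε) ≥ 0. Then the explicit upwind update map G : ℝ × ℝ^m → ℝ defined by G(v₀, v) = v₀ − Δt·H̃(((v_j − v₀)/Δh)_{j=1,…,m}) is monotone: G is nondecreasing in v₀ and nondecreasing in each coordinate v_j. -/

import Mathlib

/-- A probability mass function on a finite type. -/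
def IsPMF {X : Type*} [Fintype X] (q : X → ℝ) : Prop :=
  (∀ x, 0 ≤ q x) ∧ ∑ x, q x = 1

/-- KL divergence between pmfs on a finite type (convention `0 · log 0 = 0`). -/
noncomputable def KL {X : Type*} [Fintype X] (q p : X → ℝ) : ℝ :=
  ∑ x, q x * Real.log (q x / p x)

/-- The Hamiltonian `H(p) = max_a inf_{q ∈ Δ_X} Σ_i p_i D(q ‖ ν^i_a)`. -/
noncomputable def Ham {X : Type*} [Fintype X] {K m : ℕ} (ν : Fin m → Fin K → X → ℝ)
    (p : Fin m → ℝ) : ℝ :=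
  ⨆ a : Fin K, ⨅ q : {q : X → ℝ // IsPMF q}, ∑ i, p i * KL q.1 (ν i a)

theorem KL_nonneg {X : Type*} [Fintype X] {q p : X → ℝ} (hq : IsPMF q) (hp : IsPMF p)
    (hpos : ∀ x, 0 < p x) : 0 ≤ KL q p := by
  have key : ∑ x, (q x - p x) ≤ KL q p := by
    refine Finset.sum_le_sum fun x _ => ?_
    rcases (hq.1 x).eq_or_lt with h | h
    · simpa [← h] using (hpos x).le
    · calc q x - p x = q x * (1 - (q x / p x)⁻¹) := by
            have := (hpos x).ne'
            field_simp
        _ ≤ q x * Real.log (q x / p x) :=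
            mul_le_mul_of_nonneg_left
              (Real.one_sub_inv_le_log_of_pos (div_pos h (hpos x))) h.le
  rwa [Finset.sum_sub_distrib, hq.2, hp.2, sub_self] at key

theorem KL_le_log_one_div {X : Type*} [Fintype X] {q p : X → ℝ} {ε : ℝ} (hq : IsPMF q)
    (hε : 0 < ε) (hlb : ∀ x, ε ≤ p x) : KL q p ≤ Real.log (1 / ε) := by
  have key : KL q p ≤ ∑ x, q x * Real.log (1 / ε) := by
    refine Finset.sum_le_sum fun x _ => ?_
    rcases (hq.1 x).eq_or_lt with h | h
    · simp [← h]
    · have hle : q x ≤ 1 :=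
        hq.2 ▸ Finset.single_le_sum (fun y _ => hq.1 y) (Finset.mem_univ x)
      exact mul_le_mul_of_nonneg_left
        (Real.log_le_log (div_pos h (hε.trans_le (hlb x)))
          (div_le_div₀ zero_le_one hle hε (hlb x))) h.le
  rwa [← Finset.sum_mul, hq.2, one_mul] at key

/-- The Hamiltonian is nondecreasing up to an error linear in a uniform shift of its argument. -/
theorem Ham_le_add {X : Type*} [Fintype X] [Nonempty X] {K m : ℕ} (hK : 1 ≤ K)
    {ν : Fin m → Fin K → X → ℝ} (hν : ∀ i a, IsPMF (ν i a))
    {ε : ℝ} (hε : 0 < ε) (hlb : ∀ i a x, ε ≤ ν i a x)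
    {p p' : Fin m → ℝ} {c : ℝ} (hc : 0 ≤ c) (hp : ∀ j, p j ≤ p' j + c) :
    Ham ν p ≤ Ham ν p' + m * c * Real.log (1 / ε) := by
  classical
  have : Nonempty (Fin K) := ⟨⟨0, hK⟩⟩
  obtain ⟨x₀⟩ := ‹Nonempty X›
  have : Nonempty {q : X → ℝ // IsPMF q} :=
    ⟨⟨Pi.single x₀ 1, fun x => by by_cases h : x = x₀ <;> simp [h], by simp⟩⟩
  have hnn (q : {q : X → ℝ // IsPMF q}) (i a) : 0 ≤ KL q.1 (ν i a) :=
    KL_nonneg q.2 (hν i a) fun x => hε.trans_le (hlb i a x)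
  have hub (q : {q : X → ℝ // IsPMF q}) (i a) : KL q.1 (ν i a) ≤ Real.log (1 / ε) :=
    KL_le_log_one_div q.2 hε (hlb i a)
  refine ciSup_le fun a => ?_
  have hsup : (⨅ q : {q : X → ℝ // IsPMF q}, ∑ i, p' i * KL q.1 (ν i a)) ≤ Ham ν p' :=
    le_ciSup (f := fun a => ⨅ q : {q : X → ℝ // IsPMF q}, ∑ i, p' i * KL q.1 (ν i a))
      (Set.finite_range _).bddAbove a
  have hbdd : BddBelow
      (Set.range fun q : {q : X → ℝ // IsPMF q} => ∑ i, p i * KL q.1 (ν i a)) := by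
    refine ⟨∑ i, -(|p i| * Real.log (1 / ε)), ?_⟩
    rintro _ ⟨q, rfl⟩
    refine Finset.sum_le_sum fun i _ => ?_
    have h₁ := mul_le_mul_of_nonneg_right (neg_abs_le (p i)) (hnn q i a)
    have h₂ := mul_le_mul_of_nonneg_left (hub q i a) (abs_nonneg (p i))
    linarith
  have hinf : (⨅ q : {q : X → ℝ // IsPMF q}, ∑ i, p i * KL q.1 (ν i a))
      - m * c * Real.log (1 / ε) ≤
      ⨅ q : {q : X → ℝ // IsPMF q}, ∑ i, p' i * KL q.1 (ν i a) := by
    refine le_ciInf fun q => ?_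
    have hsum : ∑ i, p i * KL q.1 (ν i a) ≤
        ∑ i, (p' i * KL q.1 (ν i a) + c * Real.log (1 / ε)) := by
      refine Finset.sum_le_sum fun i _ => ?_
      have h₁ := mul_le_mul_of_nonneg_right (hp i) (hnn q i a)
      have h₂ := mul_le_mul_of_nonneg_left (hub q i a) hc
      linarith
    rw [Finset.sum_add_distrib, Finset.sum_const, Finset.card_univ, Fintype.card_fin,
      nsmul_eq_mul, ← mul_assoc] at hsum
    linarith [ciInf_le hbdd q]
  linarith

/-- **Lemma 5 of the paper (monotonicity of the explicit upwind scheme).**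
Under the CFL condition `1 − (m Δt/Δh) log(1/ε) ≥ 0`, the explicit upwind update
`G(v₀, v) = v₀ − Δt·H̃(((v_j − v₀)/Δh)_j)` (with `H̃ = −H`) is nondecreasing in `v₀`
and in each coordinate `v_j`. -/
theorem stmt_9 {X : Type*} [Fintype X] [Nonempty X] (K m : ℕ) (hK : 1 ≤ K) (hm : 2 ≤ m)
    (ν : Fin m → Fin K → X → ℝ) (hν : ∀ i a, IsPMF (ν i a))
    (ε : ℝ) (hε0 : 0 < ε) (hε1 : ε ≤ 1) (hlb : ∀ i a x, ε ≤ ν i a x)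
    (Δt Δh : ℝ) (hΔt : 0 < Δt) (hΔh : 0 < Δh)
    (hcfl : 0 ≤ 1 - (m : ℝ) * Δt / Δh * Real.log (1 / ε))
    (G : ℝ → (Fin m → ℝ) → ℝ)
    (hG : ∀ v₀ v, G v₀ v = v₀ - Δt * (-Ham ν (fun j => (v j - v₀) / Δh))) :
    (∀ v : Fin m → ℝ, ∀ v₀ v₀' : ℝ, v₀ ≤ v₀' → G v₀ v ≤ G v₀' v) ∧
    (∀ v₀ : ℝ, ∀ v v' : Fin m → ℝ, (∀ j, v j ≤ v' j) → G v₀ v ≤ G v₀ v') := by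
  refine ⟨fun v v₀ v₀' h => ?_, fun v₀ v v' h => ?_⟩
  · have hH := Ham_le_add hK hν hε0 hlb (p := fun j => (v j - v₀) / Δh)
      (p' := fun j => (v j - v₀') / Δh) (c := (v₀' - v₀) / Δh)
      (div_nonneg (sub_nonneg.2 h) hΔh.le) (fun j => le_of_eq (by ring))
    have hscaled := mul_le_mul_of_nonneg_left hH hΔt.le
    have hshift := mul_nonneg (sub_nonneg.2 h) hcfl
    have hcomm : Δt * (m * ((v₀' - v₀) / Δh) * Real.log (1 / ε)) =
        (v₀' - v₀) * (m * Δt / Δh * Real.log (1 / ε)) := by ring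
    rw [hG, hG]
    linarith
  · have hH := Ham_le_add hK hν hε0 hlb (p := fun j => (v j - v₀) / Δh)
      (p' := fun j => (v' j - v₀) / Δh) le_rfl (fun j => by
        rw [add_zero]
        exact div_le_div_of_nonneg_right (sub_le_sub_right (h j) v₀) hΔh.le)
    rw [mul_zero, zero_mul, add_zero] at hH
    have hscaled := mul_le_mul_of_nonneg_left hH hΔt.le
    rw [hG, hG]
    linarith
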